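/- arXiv:math/0703549 — 4 statements merged into one kernel-verified Lean document; each statement's English description precedes it below -/
import Mathlib

section
/- For every rational n-set S of P¹ and all γ, ρ ∈ GL₂(𝔽_q), one has J(ρ,S) · J(γ, ρ(S)) = J(γρ, S). -/
noncomputable section

open Polynomial

namespace Hyp

attribute [local instance] Classical.propDecidable Classical.decEq

variable (F : Type) [Field F] [Fintype F]

/-- The embedding of `F` into its algebraic closure. -/
def em : F →+* AlgebraicClosure F := algebraMap F (AlgebraicClosure F)

/-- The Frobenius `t ↦ t^q` acting on `P¹(k̄) = k̄ ∪ {∞}`, where `∞ = none`. -/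
def frobP1 : Option (AlgebraicClosure F) → Option (AlgebraicClosure F) :=
  Option.map fun x => x ^ Fintype.card F

variable {F}

/-- The Möbius action of a `2×2` matrix `(a b; c d)` over `F` on `P¹(k̄) = k̄ ∪ {∞}`:
`t ↦ (at+b)/(ct+d)`, with the usual conventions at `∞` and at poles. -/
def moebius (γ : Matrix (Fin 2) (Fin 2) F) :
    Option (AlgebraicClosure F) → Option (AlgebraicClosure F)
  | none =>
      if γ 1 0 = 0 then none else some (em F (γ 0 0) / em F (γ 1 0))
  | some x =>
      if em F (γ 1 0) * x + em F (γ 1 1) = 0 then none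
      else some ((em F (γ 0 0) * x + em F (γ 0 1)) / (em F (γ 1 0) * x + em F (γ 1 1)))

/-- The local multiplier `j(γ,t)`. -/
def locMult (γ : Matrix (Fin 2) (Fin 2) F) :
    Option (AlgebraicClosure F) → AlgebraicClosure F
  | none => if γ 1 0 = 0 then em F (γ 1 1) else em F (-γ.det / γ 1 0)
  | some x =>
      if em F (γ 1 0) * x + em F (γ 1 1) = 0 then em F (γ 1 0)
      else em F γ.det / (em F (γ 1 0) * x + em F (γ 1 1))

/-- The global multiplier `J(γ,S) = ∏_{t ∈ S} j(γ,t)`. -/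
def Jmult (γ : Matrix (Fin 2) (Fin 2) F) (S : Finset (Option (AlgebraicClosure F))) :
    AlgebraicClosure F :=
  ∏ t ∈ S, locMult γ t

/-- `S` is a rational `n`-set of `P¹`: it has `n` elements and is Frobenius-stable. -/
def IsRatSet (n : ℕ) (S : Finset (Option (AlgebraicClosure F))) : Prop :=
  S.card = n ∧ S.image (frobP1 F) = S

/-- `m` is the order of `γ` in `PGL₂(F)`: the least positive integer such that `γ^m`
is a scalar matrix. -/
def IsPGLOrder (γ : Matrix (Fin 2) (Fin 2) F) (m : ℕ) : Prop :=
  IsLeast {n : ℕ | 0 < n ∧ ∃ lam : F, γ ^ n = lam • (1 : Matrix (Fin 2) (Fin 2) F)} m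

/-- `J(γ,S)` is a square in `F*`. -/
def IsSquareJ (γ : Matrix (Fin 2) (Fin 2) F) (S : Finset (Option (AlgebraicClosure F))) : Prop :=
  ∃ v : F, v ≠ 0 ∧ Jmult γ S = em F (v * v)

/-- The monic polynomial `f_S(x) = ∏_{t ∈ S, t ≠ ∞} (x - t)` attached to a finite subset
of `P¹(k̄)`. -/
def fpoly (S : Finset (Option (AlgebraicClosure F))) : Polynomial (AlgebraicClosure F) :=
  ∏ t ∈ S, t.elim 1 fun a => X - C a

/-- `t` belongs to `P¹(F) = F ∪ {∞}` inside `P¹(k̄)`. -/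
def inP1k (t : Option (AlgebraicClosure F)) : Prop :=
  t = none ∨ ∃ x : F, t = some (em F x)

/-- `t` belongs to `P¹(𝔽_{q²})` inside `P¹(k̄)`. -/
def inP1k2 [Fintype F] (t : Option (AlgebraicClosure F)) : Prop :=
  t = none ∨ ∃ x : AlgebraicClosure F, x ^ Fintype.card F ^ 2 = x ∧ t = some x

/-- Normalized homogeneous coordinates of a point of `P¹(k̄)`: `(x, 1)` for `x` finite and
`(-1, 0)` for `∞`. With this choice of sign at `∞`, the local multiplier satisfies
`locMult_smul_mulVec_homCoords` without exceptional signs. -/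
def homCoords : Option (AlgebraicClosure F) → Fin 2 → AlgebraicClosure F
  | none => ![-1, 0]
  | some x => ![x, 1]

omit [Fintype F] in
theorem homCoords_ne_zero (t : Option (AlgebraicClosure F)) : homCoords t ≠ 0 := by
  intro h
  have h0 := congrFun h 0
  have h1 := congrFun h 1
  cases t <;> simp [homCoords] at h0 h1

omit [Fintype F] in
theorem eq_and_eq_of_smul_homCoords_eq {a b : AlgebraicClosure F} (ha : a ≠ 0) (hb : b ≠ 0)
    {s t : Option (AlgebraicClosure F)} (h : a • homCoords s = b • homCoords t) :
    s = t ∧ a = b := by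
  have h0 := congrFun h 0
  have h1 := congrFun h 1
  cases s <;> cases t <;> simp_all [homCoords]

omit [Fintype F] in
theorem em_eq_zero_iff {a : F} : em F a = 0 ↔ a = 0 :=
  map_eq_zero (em F)

omit [Fintype F] in
/-- The local multiplier compares the linear action on homogeneous coordinates with the
Möbius action. -/
theorem locMult_smul_mulVec_homCoords (γ : Matrix (Fin 2) (Fin 2) F)
    (t : Option (AlgebraicClosure F)) :
    locMult γ t • (γ.map (em F)).mulVec (homCoords t) =
      em F γ.det • homCoords (moebius γ t) := by
  cases t with
  | none =>
    by_cases hc : γ 1 0 = 0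
    · ext i
      fin_cases i <;>
        simp [locMult, moebius, homCoords, hc, Matrix.det_fin_two, mul_comm]
    · have hc' : em F (γ 1 0) ≠ 0 := mt em_eq_zero_iff.1 hc
      ext i
      fin_cases i <;>
        simp [locMult, moebius, homCoords, hc]
      all_goals field_simp
  | some x =>
    by_cases hp : em F (γ 1 0) * x + em F (γ 1 1) = 0
    · ext i
      fin_cases i
      · simp [locMult, moebius, homCoords, hp, Matrix.det_fin_two]
        linear_combination em F (γ 0 0) * hp
      · simp [locMult, moebius, homCoords, hp]
    · ext i
      fin_cases i <;>
        simp [locMult, moebius, homCoords, hp]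
      all_goals field_simp

omit [Fintype F] in
theorem locMult_ne_zero {γ : Matrix (Fin 2) (Fin 2) F} (hγ : γ.det ≠ 0)
    (t : Option (AlgebraicClosure F)) : locMult γ t ≠ 0 := by
  intro h
  have key := locMult_smul_mulVec_homCoords γ t
  rw [h, zero_smul] at key
  exact smul_ne_zero (mt em_eq_zero_iff.1 hγ) (homCoords_ne_zero _) key.symm

omit [Fintype F] in
theorem moebius_injective {γ : Matrix (Fin 2) (Fin 2) F} (hγ : γ.det ≠ 0) :
    Function.Injective (moebius γ) := by
  intro s t hst
  have hs := locMult_smul_mulVec_homCoords γ s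
  rw [hst, ← locMult_smul_mulVec_homCoords γ t, ← Matrix.mulVec_smul, ← Matrix.mulVec_smul] at hs
  have hdet : IsUnit (γ.map (em F)) := by
    rw [Matrix.isUnit_iff_isUnit_det, ← RingHom.mapMatrix_apply, ← RingHom.map_det]
    exact isUnit_iff_ne_zero.2 (mt em_eq_zero_iff.1 hγ)
  exact (eq_and_eq_of_smul_homCoords_eq (locMult_ne_zero hγ s) (locMult_ne_zero hγ t)
    (Matrix.mulVec_injective_of_isUnit hdet hs)).1

omit [Fintype F] in
/-- The local multiplier is a cocycle for the Möbius action. -/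
theorem locMult_mul {γ ρ : Matrix (Fin 2) (Fin 2) F} (hγ : γ.det ≠ 0) (hρ : ρ.det ≠ 0)
    (t : Option (AlgebraicClosure F)) :
    locMult (γ * ρ) t = locMult ρ t * locMult γ (moebius ρ t) := by
  have hdet : em F (γ * ρ).det ≠ 0 := by
    rw [Matrix.det_mul]
    exact mt em_eq_zero_iff.1 (mul_ne_zero hγ hρ)
  have hcomp : (locMult ρ t * locMult γ (moebius ρ t)) •
      ((γ * ρ).map (em F)).mulVec (homCoords t) =
        em F (γ * ρ).det • homCoords (moebius γ (moebius ρ t)) := by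
    rw [Matrix.map_mul, ← Matrix.mulVec_mulVec, mul_comm, mul_smul, ← Matrix.mulVec_smul,
      locMult_smul_mulVec_homCoords, Matrix.mulVec_smul, smul_comm,
      locMult_smul_mulVec_homCoords, smul_smul, Matrix.det_mul, map_mul, mul_comm]
  have hprod := locMult_smul_mulVec_homCoords (γ * ρ) t
  have hne : locMult ρ t * locMult γ (moebius ρ t) ≠ 0 :=
    mul_ne_zero (locMult_ne_zero hρ _) (locMult_ne_zero hγ _)
  have hne' : locMult (γ * ρ) t ≠ 0 := by
    apply locMult_ne_zero
    rw [Matrix.det_mul]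
    exact mul_ne_zero hγ hρ
  have heq := congrArg (fun v => locMult (γ * ρ) t • v) hcomp
  rw [smul_comm, hprod, smul_smul, smul_smul] at heq
  have := (eq_and_eq_of_smul_homCoords_eq (mul_ne_zero hne hdet) (mul_ne_zero hne' hdet) heq).2
  exact (mul_right_cancel₀ hdet this).symm

theorem stmt1 {F : Type} [Field F] [Fintype F] (hq : Odd (Fintype.card F))
    (n : ℕ) (S : Finset (Option (AlgebraicClosure F))) (hS : IsRatSet n S)
    (γ ρ : GL (Fin 2) F) :
    Jmult ρ.val S * Jmult γ.val (S.image (moebius ρ.val)) = Jmult (γ * ρ).val S := by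
  have hdet : ∀ δ : GL (Fin 2) F, δ.val.det ≠ 0 := fun δ =>
    ((Matrix.isUnit_iff_isUnit_det _).1 δ.isUnit).ne_zero
  unfold Jmult
  rw [Finset.prod_image (moebius_injective (hdet ρ)).injOn, ← Finset.prod_mul_distrib]
  exact Finset.prod_congr rfl fun t _ => (locMult_mul (hdet γ) (hdet ρ) t).symm

end Hyp
end
end

section
/- Let n be an even integer, S a rational n-set of P¹, and γ ∈ GL₂(𝔽_q) a non-scalar matrix with γ(S) = S; let m be the order of γ in PGL₂(𝔽_q). Then J(γ,S) is a square in k* if and only if ε(γ,S) = 1, where: ε(γ,S) = (−1)^{(q−1)/m} if γ = diag(λ,1) for some λ ∈ k* (so γ(t) = λt and m is the multiplicative order of λ, which divides q−1) and ∞ ∈ S; ε(γ,S) = 1 if γ = diag(λ,1) and ∞ ∉ S; ε(γ,S) = 1 if γ = (1 1; 0 1) (so γ(t) = t+1); ε(γ,S) = (−1)^{(q+1)/m}·(−1)^{(n−2)/m} if γ is potentially homothetic and Fix_γ ⊆ S (in which case m divides both q+1 and n−2); and ε(γ,S) = (−1)^{n/m} if γ is potentially homothetic and Fix_γ ⊄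 S (in which case m divides both q+1 and n). -/
noncomputable section

open Polynomial

namespace Hyp

attribute [local instance] Classical.propDecidable Classical.decEq

variable (F : Type) [Field F] [Fintype F]

variable {F}

set_option linter.unusedSectionVars false

/-- An eigenvector `(t, 1)` with `t ∉ F` detects scalar powers through its eigenvalue. -/
theorem pow_eq_smul_one_iff (γ : Matrix (Fin 2) (Fin 2) F) {t : AlgebraicClosure F}
    (ht : ∀ x : F, em F x ≠ t)
    (hfix : em F (γ 0 0) * t + em F (γ 0 1) = (em F (γ 1 0) * t + em F (γ 1 1)) * t)
    (k : ℕ) (lam : F) :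
    γ ^ k = lam • (1 : Matrix (Fin 2) (Fin 2) F) ↔
      (em F (γ 1 0) * t + em F (γ 1 1)) ^ k = em F lam := by
  set β := em F (γ 1 0) * t + em F (γ 1 1) with hβ
  have key : ∀ k : ℕ, em F ((γ ^ k) 0 0) * t + em F ((γ ^ k) 0 1) = β ^ k * t ∧
      em F ((γ ^ k) 1 0) * t + em F ((γ ^ k) 1 1) = β ^ k := by
    intro k
    induction k with
    | zero => simp
    | succ k ih =>
      obtain ⟨h0, h1⟩ := ih
      simp only [pow_succ, Matrix.mul_apply, Fin.sum_univ_two, map_add, map_mul]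
      constructor
      · linear_combination em F ((γ ^ k) 0 0) * hfix - em F ((γ ^ k) 0 1) * hβ + β * h0
      · linear_combination em F ((γ ^ k) 1 0) * hfix - em F ((γ ^ k) 1 1) * hβ + β * h1
  have indep : ∀ p r : F, em F p * t + em F r = 0 → p = 0 ∧ r = 0 := by
    intro p r h
    by_cases hp : p = 0
    · subst hp
      simpa using h
    · have hp' : em F p ≠ 0 := by simpa using hp
      refine absurd ?_ (ht (-r / p))
      rw [map_div₀, map_neg, div_eq_iff hp']
      linear_combination -h
  obtain ⟨h0, h1⟩ := key k
  constructor
  · intro h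
    simpa [h] using h1.symm
  · intro h
    obtain ⟨e00, e01⟩ := indep ((γ ^ k) 0 0 - lam) ((γ ^ k) 0 1) (by
      rw [map_sub]; linear_combination h0 + t * h)
    obtain ⟨e10, e11⟩ := indep ((γ ^ k) 1 0) ((γ ^ k) 1 1 - lam) (by
      rw [map_sub]; linear_combination h1 + h)
    ext i j
    fin_cases i <;> fin_cases j <;> simp [e01, e10, sub_eq_zero.mp e00, sub_eq_zero.mp e11]

/-- The local multiplier is, away from a finite fixed point, a constant times a coboundary. -/
theorem Jmult_eq_of_fixed (γ : Matrix (Fin 2) (Fin 2) F) (hdet : γ.det ≠ 0) (hc : γ 1 0 ≠ 0)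
    {t : AlgebraicClosure F}
    (hfix : em F (γ 0 0) * t + em F (γ 0 1) = (em F (γ 1 0) * t + em F (γ 1 1)) * t)
    (S : Finset (Option (AlgebraicClosure F))) (hstab : S.image (moebius γ) = S) :
    Jmult γ S = (em F (γ 1 0) * t + em F (γ 1 1)) ^ S.card *
      if some t ∈ S then em F γ.det / (em F (γ 1 0) * t + em F (γ 1 1)) ^ 2 else 1 := by
  have hdet' : em F γ.det ≠ 0 := by simpa using hdet
  have hc' : em F (γ 1 0) ≠ 0 := by simpa using hc
  have hD : em F γ.det =
      em F (γ 0 0) * em F (γ 1 1) - em F (γ 0 1) * em F (γ 1 0) := by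
    rw [Matrix.det_fin_two, map_sub, map_mul, map_mul]
  set a := em F (γ 0 0)
  set b := em F (γ 0 1)
  set c := em F (γ 1 0)
  set d := em F (γ 1 1)
  set D := em F γ.det
  set β := c * t + d with hβ
  have hprod : β * (a - c * t) = D := by
    rw [hD, hβ]; rw [hβ] at hfix; linear_combination c * hfix
  have hβ0 : β ≠ 0 := by
    intro h; rw [h, zero_mul] at hprod; exact hdet' hprod.symm
  let H : Option (AlgebraicClosure F) → AlgebraicClosure F := fun s =>
    if s = some t then 1 else s.elim (-1) fun x => x - t
  have hH : ∀ s, H s ≠ 0 := by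
    intro s
    by_cases h : s = some t
    · simp [H, h]
    · cases s with
      | none => simp [H]
      | some x =>
        have hx : x ≠ t := fun e => h (by rw [e])
        simpa [H, hx] using sub_ne_zero.mpr hx
  have hloc : ∀ s, locMult γ s =
      β * (H (moebius γ s) / H s) * if s = some t then D / β ^ 2 else 1 := by
    intro s
    cases s with
    | none =>
      have hne : a / c ≠ t := by
        intro h
        rw [div_eq_iff hc'] at h
        apply hdet'
        rw [← hprod, h]; ring
      have hm : moebius γ none = some (a / c) := if_neg hc
      have hl : locMult γ none = -D / c :=
        (if_neg hc).trans (by rw [map_div₀, map_neg])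
      rw [hm, hl]
      simp only [H, Option.some.injEq, hne, reduceCtorEq, if_false, Option.elim]
      rw [← hprod]
      field_simp
    | some x =>
      by_cases hx : x = t
      · subst hx
        have hm : moebius γ (some x) = some x := by
          simp only [moebius]
          change (if β = 0 then none else some ((a * x + b) / β)) = some x
          rw [if_neg hβ0, hfix, mul_div_cancel_left₀ _ hβ0]
        rw [hm]
        simp only [locMult, H, if_true]
        change (if β = 0 then c else D / β) = _
        rw [if_neg hβ0]
        field_simp
      · have hxt : x - t ≠ 0 := sub_ne_zero.mpr hx
        by_cases hp : c * x + d = 0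
        · have hm : moebius γ (some x) = none := if_pos hp
          have hl : locMult γ (some x) = c := if_pos hp
          rw [hm, hl]
          simp only [H, reduceCtorEq, if_false, Option.some.injEq, hx, Option.elim]
          field_simp
          rw [hβ]
          linear_combination hp
        · have hm : moebius γ (some x) = some ((a * x + b) / (c * x + d)) := if_neg hp
          have hl : locMult γ (some x) = D / (c * x + d) := if_neg hp
          have hsub : β * ((a * x + b) / (c * x + d) - t) = D * (x - t) / (c * x + d) := by
            rw [div_sub' hp, ← mul_div_assoc, hD, hβ]
            rw [hβ] at hfix
            congr 1
            linear_combination (c * x + d) * hfix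
          have hne : (a * x + b) / (c * x + d) ≠ t := by
            intro h
            rw [h, sub_self, mul_zero] at hsub
            exact div_ne_zero (mul_ne_zero hdet' hxt) hp hsub.symm
          rw [hm, hl]
          simp only [H, if_false, Option.some.injEq, hx, hne, Option.elim, mul_one]
          rw [← mul_div_assoc, hsub]
          field_simp
  have hinj : Set.InjOn (moebius γ) S := Finset.card_image_iff.mp (by rw [hstab])
  have hcob : ∏ s ∈ S, H (moebius γ s) = ∏ s ∈ S, H s := by
    conv_rhs => rw [← hstab]
    exact (Finset.prod_image hinj).symm
  have hS0 : ∏ s ∈ S, H s ≠ 0 := Finset.prod_ne_zero_iff.mpr fun s _ => hH s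
  rw [Jmult, Finset.prod_congr rfl fun s _ => hloc s, Finset.prod_mul_distrib,
    Finset.prod_mul_distrib, Finset.prod_div_distrib, hcob, div_self hS0, Finset.prod_const,
    mul_one, Finset.prod_ite_eq']

/-- An element of the algebraic closure fixed by Frobenius lies in `F`. -/
theorem exists_em_eq_of_pow_card_eq {x : AlgebraicClosure F} (h : x ^ Fintype.card F = x) :
    ∃ y : F, em F y = x := by
  have hroot : x ∈ ((X ^ Fintype.card F - X : F[X]).map (em F)).roots := by
    have hne : (X ^ Fintype.card F - X : F[X]) ≠ 0 :=
      FiniteField.X_pow_card_sub_X_ne_zero F Fintype.one_lt_card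
    rw [mem_roots (Polynomial.map_ne_zero hne)]
    simp [h]
  have hs : (X ^ Fintype.card F - X : F[X]).Splits := by
    rw [splits_iff_card_roots, FiniteField.roots_X_pow_card_sub_X,
      FiniteField.X_pow_card_sub_X_natDegree_eq F Fintype.one_lt_card]
    rfl
  rw [hs.roots_map, FiniteField.roots_X_pow_card_sub_X] at hroot
  obtain ⟨y, -, hy⟩ := Multiset.mem_map.mp hroot
  exact ⟨y, hy⟩

theorem isSquareJ_iff {γ : Matrix (Fin 2) (Fin 2) F} {S : Finset (Option (AlgebraicClosure F))}
    {x : F} (hx : x ≠ 0) (hJ : Jmult γ S = em F x) : IsSquareJ γ S ↔ IsSquare x := by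
  constructor
  · rintro ⟨v, -, hv⟩
    exact ⟨v, (em F).injective (hJ.symm.trans hv)⟩
  · rintro ⟨v, rfl⟩
    exact ⟨v, left_ne_zero_of_mul hx, hJ⟩

theorem isSquare_pow_iff_even {μ : F} (hμ : μ ≠ 0) (hsq : ¬ IsSquare μ) (e : ℕ) :
    IsSquare (μ ^ e) ↔ Even e := by
  refine ⟨fun h => ?_, fun h => h.isSquare_pow μ⟩
  by_contra he
  obtain ⟨k, rfl⟩ := Nat.not_even_iff_odd.mp he
  apply hsq
  have hk : IsSquare (μ ^ (2 * k)) := (even_two_mul k).isSquare_pow μ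
  have := h.div hk
  rwa [pow_succ, mul_div_cancel_left₀ _ (pow_ne_zero _ hμ)] at this

/-- Powers of `diag(lam, 1)` that are scalar. -/
theorem diag_pow_eq_smul_one_iff (lam : F) (k : ℕ) :
    (∃ x : F, (!![lam, 0; 0, 1] : Matrix (Fin 2) (Fin 2) F) ^ k = x • 1) ↔ lam ^ k = 1 := by
  have h : (!![lam, 0; 0, 1] : Matrix (Fin 2) (Fin 2) F) = Matrix.diagonal ![lam, 1] := by
    ext i j
    fin_cases i <;> fin_cases j <;> simp
  rw [h, Matrix.diagonal_pow]
  constructor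
  · rintro ⟨x, hx⟩
    have h0 := congrFun (congrFun hx 0) 0
    have h1 := congrFun (congrFun hx 1) 1
    simp at h0 h1
    rw [h0, h1]
  · intro hk
    refine ⟨1, ?_⟩
    ext i j
    fin_cases i <;> fin_cases j <;> simp [hk]

theorem isSquareJ_diag (hq : Odd (Fintype.card F)) {n : ℕ} (hn : Even n)
    {S : Finset (Option (AlgebraicClosure F))} (hcard : S.card = n) {lam : F} (hlam : lam ≠ 0)
    {m : ℕ} (hm : IsPGLOrder !![lam, 0; 0, 1] m) :
    (orderOf lam = m ∧ m ∣ Fintype.card F - 1) ∧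
      (none ∈ S → (IsSquareJ !![lam, 0; 0, 1] S ↔ (-1 : ℤ) ^ ((Fintype.card F - 1) / m) = 1)) ∧
      (none ∉ S → IsSquareJ !![lam, 0; 0, 1] S) := by
  have hlamq : lam ^ (Fintype.card F - 1) = 1 := FiniteField.pow_card_sub_one_eq_one lam hlam
  have hord : orderOf lam = m := by
    obtain ⟨⟨hm0, hm1⟩, hmin⟩ := hm
    rw [diag_pow_eq_smul_one_iff] at hm1
    refine le_antisymm (orderOf_le_of_pow_eq_one hm0 hm1) (hmin ⟨?_, ?_⟩)
    · exact orderOf_pos_iff.mpr (isOfFinOrder_iff_pow_eq_one.mpr ⟨m, hm0, hm1⟩)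
    · rw [diag_pow_eq_smul_one_iff]
      exact pow_orderOf_eq_one lam
  have hdvd : m ∣ Fintype.card F - 1 := hord ▸ orderOf_dvd_of_pow_eq_one hlamq
  have hnone : locMult !![lam, 0; 0, 1] (none : Option (AlgebraicClosure F)) = 1 := by
    simp [locMult]
  have hsome : ∀ x : AlgebraicClosure F, locMult !![lam, 0; 0, 1] (some x) = em F lam := by
    intro x
    simp [locMult, Matrix.det_fin_two]
  refine ⟨⟨hord, hdvd⟩, fun hS => ?_, fun hS => ?_⟩
  · have hJ : Jmult !![lam, 0; 0, 1] S = em F (lam ^ (n - 1)) := by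
      rw [Jmult, ← Finset.mul_prod_erase S _ hS, hnone, one_mul,
        Finset.prod_congr rfl (g := fun _ => em F lam), Finset.prod_const,
        Finset.card_erase_of_mem hS, hcard, map_pow]
      intro s hs
      cases s with
      | none => simp at hs
      | some x => exact hsome x
    have hn0 : 0 < n := hcard ▸ Finset.card_pos.mpr ⟨_, hS⟩
    have hodd : ¬ Even (n - 1) := by
      rw [Nat.not_even_iff_odd]
      exact Nat.Even.sub_odd hn0 hn odd_one
    rw [isSquareJ_iff (pow_ne_zero _ hlam) hJ]
    have hlsq : IsSquare (lam ^ (n - 1)) ↔ IsSquare lam := by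
      by_cases h : IsSquare lam
      · exact ⟨fun _ => h, fun h => h.pow _⟩
      · simp [isSquare_pow_iff_even hlam h, hodd, h]
    have hchar : ringChar F ≠ 2 := by
      intro h
      have := FiniteField.even_card_of_char_two h
      obtain ⟨k, hk⟩ := hq
      omega
    rw [hlsq, FiniteField.isSquare_iff hchar hlam, ← orderOf_dvd_iff_pow_eq_one, hord,
      neg_one_pow_eq_one_iff_even (by norm_num)]
    have hm0 : 0 < m := hm.1.1
    obtain ⟨r, hr⟩ := hq
    obtain ⟨s, hs⟩ := hdvd
    have hr' : Fintype.card F / 2 = r := by omega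
    rw [hs, Nat.mul_div_cancel_left _ hm0, hr']
    have h2r : m * s = 2 * r := by omega
    constructor
    · rintro ⟨u, rfl⟩
      exact ⟨u, Nat.eq_of_mul_eq_mul_left hm0 (by rw [h2r]; ring)⟩
    · rintro ⟨u, rfl⟩
      exact ⟨u, by linarith⟩
  · have hJ : Jmult !![lam, 0; 0, 1] S = em F (lam ^ n) := by
      rw [Jmult, Finset.prod_congr rfl (g := fun _ => em F lam), Finset.prod_const, hcard, map_pow]
      intro s hs
      cases s with
      | none => exact absurd hs hS
      | some x => exact hsome x
    exact (isSquareJ_iff (pow_ne_zero _ hlam) hJ).mpr (hn.isSquare_pow lam)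

theorem isSquareJ_translation (S : Finset (Option (AlgebraicClosure F))) :
    IsSquareJ !![1, 1; 0, 1] S := by
  refine ⟨1, one_ne_zero, ?_⟩
  rw [Jmult, mul_one, map_one]
  refine Finset.prod_eq_one fun s _ => ?_
  cases s <;> simp [locMult, Matrix.det_fin_two]

/-- An irreducible characteristic polynomial has no root in `F`. -/
theorem charpoly_fin_two_ne_zero {γ : Matrix (Fin 2) (Fin 2) F} (hirr : Irreducible γ.charpoly)
    (y : F) : y ^ 2 - (γ 0 0 + γ 1 1) * y + (γ 0 0 * γ 1 1 - γ 0 1 * γ 1 0) ≠ 0 := by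
  intro h
  have hroot : γ.charpoly.IsRoot y := by
    rw [Matrix.charpoly_fin_two, IsRoot.def]
    simpa [Matrix.trace_fin_two, Matrix.det_fin_two] using h
  have h1 := degree_eq_one_of_irreducible_of_root hirr hroot
  rw [Matrix.charpoly_degree_eq_dim] at h1
  simp at h1

theorem em_pow_card (x : F) : em F x ^ Fintype.card F = em F x := by
  rw [← map_pow, FiniteField.pow_card]

theorem add_pow_card (x y : AlgebraicClosure F) :
    (x + y) ^ Fintype.card F = x ^ Fintype.card F + y ^ Fintype.card F := by
  simpa using map_add (FiniteField.frobeniusAlgHom F (AlgebraicClosure F)) x y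

theorem pow_card_injective :
    Function.Injective fun x : AlgebraicClosure F => x ^ Fintype.card F :=
  (FiniteField.frobeniusAlgHom F (AlgebraicClosure F)).toRingHom.injective

/-- A potentially homothetic matrix has a finite fixed point outside `F`. -/
theorem exists_fixed_of_irreducible {γ : Matrix (Fin 2) (Fin 2) F}
    (hirr : Irreducible γ.charpoly) :
    γ 1 0 ≠ 0 ∧ ∃ t : AlgebraicClosure F, (∀ x : F, em F x ≠ t) ∧
      em F (γ 0 0) * t + em F (γ 0 1) = (em F (γ 1 0) * t + em F (γ 1 1)) * t := by
  have hc : γ 1 0 ≠ 0 := by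
    intro hc
    apply charpoly_fin_two_ne_zero hirr (γ 1 1)
    rw [hc]; ring
  have hc' : em F (γ 1 0) ≠ 0 := by simpa using hc
  refine ⟨hc, ?_⟩
  obtain ⟨t, ht⟩ := IsAlgClosed.exists_root
    (C (em F (γ 1 0)) * X ^ 2 + C (em F (γ 1 1) - em F (γ 0 0)) * X + C (-em F (γ 0 1)))
    (by rw [degree_quadratic hc']; norm_num)
  simp only [IsRoot.def, eval_add, eval_mul, eval_C, eval_pow, eval_X] at ht
  refine ⟨t, ?_, by linear_combination -ht⟩
  rintro x rfl
  apply charpoly_fin_two_ne_zero hirr (γ 1 0 * x + γ 1 1)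
  apply (em F).injective
  simp only [map_add, map_sub, map_mul, map_pow, map_zero]
  linear_combination em F (γ 1 0) * ht

/-- If `γ` is potentially homothetic of order `m` in `PGL₂(F)`, and `t` is a fixed point
with eigenvalue `β`, then squareness in `F` of a power of `β` is a parity condition. -/
theorem pow_mem_range_and_isSquare_iff {γ : Matrix (Fin 2) (Fin 2) F} {m : ℕ}
    (hm : IsPGLOrder γ m) {β : AlgebraicClosure F} (hβ : β ≠ 0)
    (hpow : ∀ (k : ℕ) (lam : F), γ ^ k = lam • (1 : Matrix (Fin 2) (Fin 2) F) ↔ β ^ k = em F lam)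
    {k : ℕ} {x : F} (hk : Even k) (hx : β ^ k = em F x) :
    m ∣ k ∧ (IsSquare x ↔ Even (k / m)) := by
  obtain ⟨⟨hm0, μ, hμ⟩, hmin⟩ := hm
  rw [hpow] at hμ
  have hμ0 : μ ≠ 0 := by
    rintro rfl
    rw [map_zero] at hμ
    exact pow_ne_zero _ hβ hμ
  have hle : ∀ (j : ℕ) (y : F), 0 < j → β ^ j = em F y → m ≤ j := fun j y hj hy =>
    hmin ⟨hj, y, (hpow j y).mpr hy⟩
  have hdvd : m ∣ k := by
    by_contra hnd
    have hlt := Nat.mod_lt k hm0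
    have hpos : 0 < k % m := Nat.pos_of_ne_zero fun h => hnd (Nat.dvd_of_mod_eq_zero h)
    have := hle (k % m) (x / μ ^ (k / m)) hpos (by
      rw [map_div₀, map_pow, ← hμ, ← hx, ← pow_mul,
        eq_div_iff (pow_ne_zero _ hβ), ← pow_add, Nat.mod_add_div])
    omega
  refine ⟨hdvd, ?_⟩
  obtain ⟨e, rfl⟩ := hdvd
  have hxe : x = μ ^ e := (em F).injective (by rw [← hx, map_pow, ← hμ, pow_mul])
  rw [Nat.mul_div_cancel_left _ hm0, hxe]
  rcases Nat.even_or_odd m with hme | hmo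
  · refine isSquare_pow_iff_even hμ0 ?_ e
    rintro ⟨v, rfl⟩
    obtain ⟨r, rfl⟩ := hme
    have hr : 0 < r := by omega
    have hsq : β ^ r * β ^ r = em F v * em F v := by rw [← pow_add, hμ, map_mul]
    rcases mul_self_eq_mul_self_iff.mp hsq with h | h
    · have := hle r v hr h
      omega
    · have := hle r (-v) hr (by rw [h, map_neg])
      omega
  · have he : Even e := by
      rcases Nat.even_mul.mp hk with h | h
      · exact absurd h (Nat.not_even_iff_odd.mpr hmo)
      · exact h
    exact ⟨fun _ => he, fun _ => he.isSquare_pow μ⟩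

/-- Vieta's formulas for the two fixed points of a Möbius transformation. -/
theorem fixed_mul_eq_det {K : Type*} [Field K] {a b c d t u : K} (hne : u ≠ t)
    (ht : a * t + b = (c * t + d) * t) (hu : a * u + b = (c * u + d) * u) :
    (c * u + d) * (c * t + d) = a * d - b * c := by
  have hsum : c * (u + t) = a - d := by
    apply mul_left_cancel₀ (sub_ne_zero.mpr hne)
    linear_combination ht - hu
  linear_combination (c * t + d) * hsum + c * ht

theorem moebius_eq_self_iff {γ : Matrix (Fin 2) (Fin 2) F} (hdet : γ.det ≠ 0) (hc : γ 1 0 ≠ 0)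
    {t u : AlgebraicClosure F} (hne : u ≠ t)
    (ht : em F (γ 0 0) * t + em F (γ 0 1) = (em F (γ 1 0) * t + em F (γ 1 1)) * t)
    (hu : em F (γ 0 0) * u + em F (γ 0 1) = (em F (γ 1 0) * u + em F (γ 1 1)) * u)
    (s : Option (AlgebraicClosure F)) :
    moebius γ s = s ↔ s = some t ∨ s = some u := by
  have hD : em F γ.det =
      em F (γ 0 0) * em F (γ 1 1) - em F (γ 0 1) * em F (γ 1 0) := by
    rw [Matrix.det_fin_two, map_sub, map_mul, map_mul]
  have hdet' : em F γ.det ≠ 0 := by simpa using hdet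
  have hc' : em F (γ 1 0) ≠ 0 := by simpa using hc
  have hprod := fixed_mul_eq_det hne ht hu
  rw [← hD] at hprod
  have hsum : em F (γ 1 0) * (u + t) = em F (γ 0 0) - em F (γ 1 1) := by
    apply mul_left_cancel₀ (sub_ne_zero.mpr hne)
    linear_combination ht - hu
  cases s with
  | none => simp [moebius, hc]
  | some x =>
    simp only [moebius, Option.some.injEq]
    constructor
    · intro h
      split_ifs at h with hx
      rw [Option.some.injEq, div_eq_iff hx] at h
      have hmul : em F (γ 1 0) * ((x - t) * (x - u)) = 0 := by
        linear_combination ht - h + (t - x) * hsum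
      rcases mul_eq_zero.mp ((mul_eq_zero.mp hmul).resolve_left hc') with h' | h'
      · exact Or.inl (sub_eq_zero.mp h')
      · exact Or.inr (sub_eq_zero.mp h')
    · rintro (rfl | rfl)
      · have h0 : em F (γ 1 0) * x + em F (γ 1 1) ≠ 0 := by
          rw [← hprod] at hdet'; exact right_ne_zero_of_mul hdet'
        rw [if_neg h0, ht, mul_div_cancel_left₀ _ h0]
      · have h0 : em F (γ 1 0) * x + em F (γ 1 1) ≠ 0 := by
          rw [← hprod] at hdet'; exact left_ne_zero_of_mul hdet'
        rw [if_neg h0, hu, mul_div_cancel_left₀ _ h0]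


theorem stmt5 {F : Type} [Field F] [Fintype F] (hq : Odd (Fintype.card F))
    (n : ℕ) (hn : Even n) (S : Finset (Option (AlgebraicClosure F))) (hS : IsRatSet n S)
    (γ : GL (Fin 2) F)
    (hns : ∀ lam : F, γ.val ≠ lam • (1 : Matrix (Fin 2) (Fin 2) F))
    (hstab : S.image (moebius γ.val) = S)
    (m : ℕ) (hm : IsPGLOrder γ.val m) :
    (∀ lam : F, γ.val = !![lam, 0; 0, 1] →
        (orderOf lam = m ∧ m ∣ Fintype.card F - 1) ∧
        (none ∈ S → (IsSquareJ γ.val S ↔ (-1 : ℤ) ^ ((Fintype.card F - 1) / m) = 1)) ∧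
        (none ∉ S → IsSquareJ γ.val S)) ∧
    (γ.val = !![1, 1; 0, 1] → IsSquareJ γ.val S) ∧
    (Irreducible (Matrix.charpoly γ.val) →
        ((∀ t, moebius γ.val t = t → t ∈ S) →
            m ∣ Fintype.card F + 1 ∧ m ∣ n - 2 ∧
            (IsSquareJ γ.val S ↔
              (-1 : ℤ) ^ ((Fintype.card F + 1) / m) * (-1 : ℤ) ^ ((n - 2) / m) = 1)) ∧
        (¬ (∀ t, moebius γ.val t = t → t ∈ S) →
            m ∣ Fintype.card F + 1 ∧ m ∣ n ∧
            (IsSquareJ γ.val S ↔ (-1 : ℤ) ^ (n / m) = 1))) := by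
  obtain ⟨hcard, hrat⟩ := hS
  have hdet : γ.val.det ≠ 0 := (Matrix.isUnit_iff_isUnit_det _).mp γ.isUnit |>.ne_zero
  refine ⟨?_, ?_, ?_⟩
  · intro lam hγ
    rw [hγ] at hm hdet ⊢
    exact isSquareJ_diag hq hn hcard (by simpa [Matrix.det_fin_two] using hdet) hm
  · intro hγ
    rw [hγ]
    exact isSquareJ_translation S
  · intro hirr
    obtain ⟨hc, t, htF, hfix⟩ := exists_fixed_of_irreducible hirr
    have hpow := pow_eq_smul_one_iff γ.val htF hfix
    have hJt := Jmult_eq_of_fixed γ.val hdet hc hfix S hstab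
    have hD : em F γ.val.det = em F (γ.val 0 0) * em F (γ.val 1 1) -
        em F (γ.val 0 1) * em F (γ.val 1 0) := by
      rw [Matrix.det_fin_two, map_sub, map_mul, map_mul]
    have hconj := congrArg (fun x => x ^ Fintype.card F) hfix
    simp only [mul_pow, add_pow_card, em_pow_card] at hconj
    have hJu := Jmult_eq_of_fixed γ.val hdet hc hconj S hstab
    have htu : t ^ Fintype.card F ≠ t := by
      intro h
      obtain ⟨y, hy⟩ := exists_em_eq_of_pow_card_eq h
      exact htF y hy
    have hnorm := fixed_mul_eq_det htu hfix hconj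
    rw [← hD] at hnorm
    have hdet' : em F γ.val.det ≠ 0 := by simpa using hdet
    have hβconj : (em F (γ.val 1 0) * t + em F (γ.val 1 1)) ^ Fintype.card F =
        em F (γ.val 1 0) * t ^ Fintype.card F + em F (γ.val 1 1) := by
      simp only [mul_pow, add_pow_card, em_pow_card]
    rw [← hβconj] at hJu hnorm
    have hmem : some (t ^ Fintype.card F) ∈ S ↔ some t ∈ S := by
      have hinj : Function.Injective (frobP1 F) := Option.map_injective pow_card_injective
      have h : some (t ^ Fintype.card F) = frobP1 F (some t) := rfl
      rw [h]
      conv_lhs => rw [← hrat]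
      exact hinj.mem_finset_image
    have hfixed : ∀ s, moebius γ.val s = s ↔ s = some t ∨ s = some (t ^ Fintype.card F) :=
      moebius_eq_self_iff hdet hc htu hfix hconj
    simp only [hmem] at hJu
    rw [hcard] at hJt hJu
    have hall : (∀ s, moebius γ.val s = s → s ∈ S) ↔ some t ∈ S := by
      simp only [hfixed, forall_eq_or_imp, forall_eq, hmem, and_self]
    rw [hall]
    generalize em F (γ.val 1 0) * t + em F (γ.val 1 1) = β at *
    have hβ0 : β ≠ 0 := by
      rintro rfl
      rw [mul_zero] at hnorm
      exact hdet' hnorm.symm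
    have hrange : ∀ k, β ^ k = (β ^ Fintype.card F) ^ k → ∃ x : F, β ^ k = em F x := by
      intro k hk
      obtain ⟨y, hy⟩ := exists_em_eq_of_pow_card_eq (x := β ^ k)
        (by rw [← pow_mul, mul_comm, pow_mul, ← hk])
      exact ⟨y, hy.symm⟩
    have hx0 : ∀ (k : ℕ) (x : F), β ^ k = em F x → x ≠ 0 := by
      rintro k x hk rfl
      rw [map_zero] at hk
      exact pow_ne_zero _ hβ0 hk
    have hqe : Even (Fintype.card F + 1) := hq.add_odd odd_one
    have hnorm' : β ^ (Fintype.card F + 1) = em F γ.val.det := by rw [pow_succ, hnorm]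
    have hq1 := pow_mem_range_and_isSquare_iff hm hβ0 hpow hqe hnorm'
    constructor
    · intro hS
      rw [if_pos hS] at hJt hJu
      have hn2 : 2 ≤ n := by
        have hn0 : 0 < n := hcard ▸ Finset.card_pos.mpr ⟨_, hS⟩
        obtain ⟨r, rfl⟩ := hn
        omega
      have hn2e : Even (n - 2) := (Nat.even_sub hn2).mpr (by simp [hn])
      have hsplit : ∀ y : AlgebraicClosure F, y ≠ 0 → y ^ n * (em F γ.val.det / y ^ 2) =
          em F γ.val.det * y ^ (n - 2) := by
        intro y hy
        obtain ⟨r, rfl⟩ := Nat.exists_eq_add_of_le hn2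
        rw [Nat.add_sub_cancel_left, pow_add]
        field_simp
      rw [hsplit _ hβ0] at hJt
      rw [hsplit _ (pow_ne_zero _ hβ0)] at hJu
      obtain ⟨x, hx⟩ := hrange (n - 2) (mul_left_cancel₀ hdet' (hJt.symm.trans hJu))
      have hnx := pow_mem_range_and_isSquare_iff hm hβ0 hpow hn2e hx
      refine ⟨hq1.1, hnx.1, ?_⟩
      have hJ : Jmult γ.val S = em F (γ.val.det * x) := by rw [hJt, hx, map_mul]
      have htot := pow_mem_range_and_isSquare_iff hm hβ0 hpow (hqe.add hn2e)
        (x := γ.val.det * x) (by rw [pow_add, hnorm', hx, map_mul])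
      rw [isSquareJ_iff (mul_ne_zero hdet (hx0 _ _ hx)) hJ, htot.2, ← pow_add,
        neg_one_pow_eq_one_iff_even (by norm_num), Nat.add_div_of_dvd_right hq1.1]
    · intro hS
      rw [if_neg hS, mul_one] at hJt hJu
      obtain ⟨x, hx⟩ := hrange n (hJt.symm.trans hJu)
      have hnx := pow_mem_range_and_isSquare_iff hm hβ0 hpow hn hx
      refine ⟨hq1.1, hnx.1, ?_⟩
      rw [isSquareJ_iff (hx0 _ _ hx) (hJt.trans hx), hnx.2,
        neg_one_pow_eq_one_iff_even (by norm_num)]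


end Hyp
end
end

section
/- Let γ = (0 1; c d) ∈ GL₂(𝔽_q) be a matrix whose characteristic polynomial is irreducible over 𝔽_q, with eigenvalues α, α^q ∈ 𝔽_{q²} ∖ 𝔽_q, and let m be the order of γ in PGL₂(𝔽_q). Let t ∈ P¹(k̄) be a point with γ(t) ≠ t, and let O_γ(t) = {γ^i(t) : i ∈ ℕ} be its orbit under the cyclic group generated by γ (this orbit has exactly m elements). Then J(γ, O_γ(t)) = α^m (an element of 𝔽_q*). -/
noncomputable section

open Polynomial

namespace Hyp

attribute [local instance] Classical.propDecidable Classical.decEq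

variable (F : Type) [Field F] [Fintype F]

variable {F}

/-- The standard lift of a point of `P¹(k̄)` to a vector: `(x, 1)`, and `(1, 0)` for `∞`. -/
def liftVec : Option (AlgebraicClosure F) → Fin 2 → AlgebraicClosure F
  | none => ![1, 0]
  | some x => ![x, 1]

/-- The factor by which `(0 1; c d)` rescales the standard lift of a point. -/
def liftFactor (c d : F) : Option (AlgebraicClosure F) → AlgebraicClosure F
  | none => em F c
  | some x => if em F c * x + em F d = 0 then 1 else em F c * x + em F d

/-- The sign `-1` at `∞` and `1` at finite points. -/
def inftySign : Option (AlgebraicClosure F) → AlgebraicClosure F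
  | none => -1
  | some _ => 1

omit [Fintype F] in
theorem inftySign_mul_self (t : Option (AlgebraicClosure F)) :
    inftySign t * inftySign t = 1 := by
  cases t <;> simp [inftySign]

omit [Fintype F] in
theorem liftVec_ne_zero (t : Option (AlgebraicClosure F)) : liftVec t ≠ 0 := by
  intro h
  cases t with
  | none => simpa [liftVec] using congrFun h 0
  | some x => simpa [liftVec] using congrFun h 1

omit [Fintype F] in
theorem eq_of_liftVec_eq_smul {s t : Option (AlgebraicClosure F)} {k : AlgebraicClosure F}
    (h : liftVec s = k • liftVec t) : s = t := by
  have h0 := congrFun h 0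
  have h1 := congrFun h 1
  rcases s with - | x <;> rcases t with - | y <;> simp [liftVec] at h0 h1 ⊢
  · simp [← h1] at h0
  · simpa [← h1] using h0

omit [Fintype F] in
theorem liftFactor_ne_zero {c : F} (hc : c ≠ 0) (d : F) (t : Option (AlgebraicClosure F)) :
    liftFactor c d t ≠ 0 := by
  cases t with
  | none => simpa [liftFactor] using hc
  | some x =>
    simp only [liftFactor]
    split_ifs with h
    exacts [one_ne_zero, h]

omit [Fintype F] in
theorem mulVec_liftVec {c : F} (hc : c ≠ 0) (d : F) (t : Option (AlgebraicClosure F)) :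
    (!![0, 1; c, d].map (em F)).mulVec (liftVec t) =
      liftFactor c d t • liftVec (moebius !![0, 1; c, d] t) := by
  cases t with
  | none =>
    ext i
    fin_cases i <;> simp [moebius, hc, liftVec, liftFactor, Matrix.mulVec, dotProduct]
  | some x =>
    by_cases h : em F c * x + em F d = 0
    · ext i
      fin_cases i <;> simp [moebius, h, liftVec, liftFactor, Matrix.mulVec, dotProduct]
    · ext i
      fin_cases i <;> simp [moebius, h, liftVec, liftFactor, Matrix.mulVec, dotProduct]

omit [Fintype F] in
theorem pow_mulVec_liftVec {c : F} (hc : c ≠ 0) (d : F) (t : Option (AlgebraicClosure F)) (n : ℕ) :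
    ((!![0, 1; c, d] ^ n).map (em F)).mulVec (liftVec t) =
      (∏ i ∈ Finset.range n, liftFactor c d ((moebius !![0, 1; c, d])^[i] t)) •
        liftVec ((moebius !![0, 1; c, d])^[n] t) := by
  induction n with
  | zero => simp
  | succ n ih =>
    rw [pow_succ', Matrix.map_mul, ← Matrix.mulVec_mulVec, ih, Matrix.mulVec_smul,
      mulVec_liftVec hc, smul_smul, Finset.prod_range_succ, Function.iterate_succ_apply']

omit [Fintype F] in
theorem smul_one_map_mulVec (lam : F) (v : Fin 2 → AlgebraicClosure F) :
    ((lam • (1 : Matrix (Fin 2) (Fin 2) F)).map (em F)).mulVec v = em F lam • v := by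
  ext i
  fin_cases i <;> simp [Matrix.mulVec, dotProduct]

omit [Fintype F] in
theorem exists_pow_eq_smul_add_smul_one (c d : F) (n : ℕ) :
    ∃ a b : F, !![0, 1; c, d] ^ n =
      a • !![0, 1; c, d] + b • (1 : Matrix (Fin 2) (Fin 2) F) := by
  induction n with
  | zero => exact ⟨0, 1, by simp⟩
  | succ n ih =>
    obtain ⟨a, b, h⟩ := ih
    refine ⟨a * d + b, a * c, ?_⟩
    rw [pow_succ, h]
    ext i j
    fin_cases i <;> fin_cases j <;> simp [Matrix.mul_apply] <;> ring

omit [Fintype F] in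
theorem locMult_mul_liftFactor {c : F} (hc : c ≠ 0) (d : F) (t : Option (AlgebraicClosure F)) :
    locMult !![0, 1; c, d] t * liftFactor c d t =
      inftySign t * inftySign (moebius !![0, 1; c, d] t) * em F (-c) := by
  cases t with
  | none => simp [locMult, liftFactor, moebius, inftySign, hc]
  | some x =>
    by_cases h : em F c * x + em F d = 0 <;>
      simp [locMult, liftFactor, moebius, inftySign, h]

omit [Fintype F] in
theorem pow_eq_smul_one_of_iterate_eq {c : F} (hc : c ≠ 0) (d : F)
    {t : Option (AlgebraicClosure F)} (ht : moebius !![0, 1; c, d] t ≠ t) {n : ℕ}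
    (h : (moebius !![0, 1; c, d])^[n] t = t) :
    ∃ lam : F, !![0, 1; c, d] ^ n = lam • (1 : Matrix (Fin 2) (Fin 2) F) := by
  obtain ⟨a, b, hab⟩ := exists_pow_eq_smul_add_smul_one c d n
  by_cases ha : a = 0
  · exact ⟨b, by simpa [ha] using hab⟩
  refine absurd ?_ ht
  have key := pow_mulVec_liftVec hc d t n
  rw [h, hab, Matrix.map_add _ (map_add (em F)), Matrix.add_mulVec, smul_one_map_mulVec,
    Matrix.map_smul' _ _ _ (map_mul (em F)), Matrix.smul_mulVec, mulVec_liftVec hc, smul_smul,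
    ← eq_sub_iff_add_eq, ← sub_smul] at key
  have hne : em F a * liftFactor c d t ≠ 0 :=
    mul_ne_zero (by simpa using ha) (liftFactor_ne_zero hc d t)
  have hsmul := (eq_inv_smul_iff₀ hne).2 key
  rw [smul_smul] at hsmul
  exact eq_of_liftVec_eq_smul hsmul

omit [Fintype F] in
theorem iterate_eq_of_pow_eq_smul_one {c : F} (hc : c ≠ 0) (d : F)
    (t : Option (AlgebraicClosure F)) {n : ℕ} {lam : F}
    (h : !![0, 1; c, d] ^ n = lam • (1 : Matrix (Fin 2) (Fin 2) F)) :
    (moebius !![0, 1; c, d])^[n] t = t ∧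
      ∏ i ∈ Finset.range n, liftFactor c d ((moebius !![0, 1; c, d])^[i] t) = em F lam := by
  have key := pow_mulVec_liftVec hc d t n
  have hP : ∏ i ∈ Finset.range n, liftFactor c d ((moebius !![0, 1; c, d])^[i] t) ≠ 0 :=
    Finset.prod_ne_zero_iff.2 fun i _ => liftFactor_ne_zero hc d _
  rw [h, smul_one_map_mulVec] at key
  have hfix : (moebius !![0, 1; c, d])^[n] t = t := by
    refine eq_of_liftVec_eq_smul
      (k := (∏ i ∈ Finset.range n, liftFactor c d ((moebius !![0, 1; c, d])^[i] t))⁻¹ * em F lam) ?_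
    rw [← smul_smul, key, inv_smul_smul₀ hP]
  rw [hfix] at key
  exact ⟨hfix, (smul_left_injective _ (liftVec_ne_zero t) key).symm⟩

omit [Fintype F] in
theorem pow_eq_em_of_pow_eq_smul_one {c d : F} {α : AlgebraicClosure F}
    (hα : α ^ 2 = em F d * α + em F c) {n : ℕ} {lam : F}
    (h : !![0, 1; c, d] ^ n = lam • (1 : Matrix (Fin 2) (Fin 2) F)) : α ^ n = em F lam := by
  have heig : (!![0, 1; c, d].map (em F)).mulVec ![1, α] = α • ![1, α] := by
    ext i
    fin_cases i
    · simp [Matrix.mulVec, dotProduct]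
    · simp [Matrix.mulVec, dotProduct]
      linear_combination -hα
  have hpow : ∀ k : ℕ, ((!![0, 1; c, d] ^ k).map (em F)).mulVec ![1, α] = α ^ k • ![1, α] := by
    intro k
    induction k with
    | zero => simp
    | succ k ih =>
      rw [pow_succ, Matrix.map_mul, ← Matrix.mulVec_mulVec, heig, Matrix.mulVec_smul, ih,
        smul_smul, pow_succ']
  have := congrFun (hpow n) 0
  rw [h, smul_one_map_mulVec] at this
  simpa using this.symm

omit [Fintype F] in
theorem minimalPeriod_moebius {c : F} (hc : c ≠ 0) (d : F) {m : ℕ}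
    (hm : IsPGLOrder !![0, 1; c, d] m) {t : Option (AlgebraicClosure F)}
    (ht : moebius !![0, 1; c, d] t ≠ t) :
    Function.minimalPeriod (moebius !![0, 1; c, d]) t = m := by
  obtain ⟨⟨hpos, lam, hlam⟩, hmin⟩ := hm
  have hper : Function.IsPeriodicPt (moebius !![0, 1; c, d]) m t :=
    (iterate_eq_of_pow_eq_smul_one hc d t hlam).1
  exact le_antisymm (hper.minimalPeriod_le hpos)
    (hmin ⟨hper.minimalPeriod_pos hpos, pow_eq_smul_one_of_iterate_eq hc d ht
      (Function.isPeriodicPt_minimalPeriod _ _)⟩)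

omit [Fintype F] in
theorem prod_inftySign_iterate {f : Option (AlgebraicClosure F) → Option (AlgebraicClosure F)}
    {t : Option (AlgebraicClosure F)} {m : ℕ} (h : f^[m] t = t) :
    ∏ i ∈ Finset.range m, (inftySign (f^[i] t) * inftySign (f (f^[i] t))) = 1 := by
  have hshift : ∏ i ∈ Finset.range m, inftySign (f (f^[i] t)) =
      ∏ i ∈ Finset.range m, inftySign (f^[i] t) := by
    have hne : inftySign t ≠ 0 := left_ne_zero_of_mul_eq_one (inftySign_mul_self t)
    refine mul_right_cancel₀ hne ?_
    have h1 := Finset.prod_range_succ (fun i => inftySign (f^[i] t)) m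
    rw [Finset.prod_range_succ'] at h1
    simpa [Function.iterate_succ_apply', h] using h1
  rw [Finset.prod_mul_distrib, hshift, ← Finset.prod_mul_distrib]
  exact Finset.prod_eq_one fun i _ => inftySign_mul_self _

theorem stmt6 {F : Type} [Field F] [Fintype F] (hq : Odd (Fintype.card F))
    (c d : F) (γ : GL (Fin 2) F) (hγ : γ.val = !![0, 1; c, d])
    (hirr : Irreducible (Matrix.charpoly γ.val))
    (α : AlgebraicClosure F) (hα : α ^ 2 = em F d * α + em F c)
    (m : ℕ) (hm : IsPGLOrder γ.val m)
    (t : Option (AlgebraicClosure F)) (ht : moebius γ.val t ≠ t)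
    (O : Finset (Option (AlgebraicClosure F)))
    (hO : (O : Set (Option (AlgebraicClosure F)))
        = {s | ∃ i : ℕ, (moebius γ.val)^[i] t = s}) :
    O.card = m ∧ Jmult γ.val O = α ^ m := by
  have hc : c ≠ 0 := by
    have hdet := (Matrix.isUnit_iff_isUnit_det _).1 γ.isUnit
    rw [hγ] at hdet
    simpa [Matrix.det_fin_two] using hdet
  rw [hγ] at hm ht hO ⊢
  have hperiod := minimalPeriod_moebius hc d hm ht
  obtain ⟨⟨hpos, lam, hlam⟩, -⟩ := hm
  obtain ⟨hfix, hprod⟩ := iterate_eq_of_pow_eq_smul_one hc d t hlam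
  set f := moebius !![0, 1; c, d] with hf
  have hinj : Set.InjOn (fun i => f^[i] t) (Finset.range m : Set ℕ) := by
    rw [Finset.coe_range, ← hperiod]
    exact Function.iterate_injOn_Iio_minimalPeriod
  have hO' : O = (Finset.range m).image fun i => f^[i] t := by
    ext s
    rw [← Finset.mem_coe, hO]
    simp only [Set.mem_ofPred_eq, Finset.mem_image, Finset.mem_range]
    refine ⟨fun ⟨i, hi⟩ => ⟨i % m, Nat.mod_lt _ hpos, ?_⟩, fun ⟨i, _, hi⟩ => ⟨i, hi⟩⟩
    rw [← hi, ← hperiod, Function.iterate_mod_minimalPeriod_eq]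
  refine ⟨by rw [hO', Finset.card_image_of_injOn hinj, Finset.card_range], ?_⟩
  have hJ : Jmult !![0, 1; c, d] O * em F lam = em F (-c) ^ m := by
    rw [Jmult, hO', Finset.prod_image hinj, ← hprod, ← Finset.prod_mul_distrib]
    simp only [locMult_mul_liftFactor hc, ← hf]
    rw [Finset.prod_mul_distrib, prod_inftySign_iterate hfix, one_mul, Finset.prod_const,
      Finset.card_range]
  have hdet : (-c) ^ m = lam ^ 2 := by
    simpa [Matrix.det_pow, Matrix.det_fin_two] using congrArg Matrix.det hlam
  have hlam0 : em F lam ≠ 0 := by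
    have : lam ^ 2 ≠ 0 := hdet ▸ pow_ne_zero m (neg_ne_zero.2 hc)
    simpa using this
  refine mul_right_cancel₀ hlam0 ?_
  rw [hJ, pow_eq_em_of_pow_eq_smul_one hα hlam, ← map_pow, hdet, map_pow, sq]

end Hyp
end
end

section
/- For every integer n ≥ 1, the number of n-element subsets S ⊆ k̄* = k̄ ∖ {0} with σ(S) = S equals (q−1)·(q^n − (−1)^n)/(q+1). -/
noncomputable section

open Polynomial

namespace Hyp

attribute [local instance] Classical.propDecidable Classical.decEq

variable (F : Type) [Field F] [Fintype F]

variable {F}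

/-- The multisets of cardinality `n` stable under `φ`. -/
abbrev StableMultiset {α : Type*} (φ : α → α) (n : ℕ) : Type _ :=
  {s : Multiset α // s.card = n ∧ s.map φ = s}

/-- The finite subsets of cardinality `n` stable under `φ`. -/
def stableFinsets {α : Type*} (φ : α → α) (n : ℕ) : Set (Finset α) :=
  {S | S.card = n ∧ S.val.map φ = S.val}

theorem exists_eq_two_nsmul_add_val {α : Type*} (s : Multiset α) :
    ∃ (g : Multiset α) (h : Finset α), s = 2 • g + h.val := by
  induction s using Multiset.induction_on with
  | empty => exact ⟨0, ∅, by simp⟩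
  | cons a s ih =>
    obtain ⟨g, h, rfl⟩ := ih
    by_cases ha : a ∈ h
    · refine ⟨a ::ₘ g, h.erase a, ?_⟩
      conv_lhs => rw [← Finset.insert_erase ha,
        Finset.insert_val_of_notMem (Finset.notMem_erase a h)]
      simp only [← Multiset.singleton_add, two_nsmul]
      abel
    · refine ⟨g, insert a h, ?_⟩
      rw [Finset.insert_val_of_notMem ha, Multiset.add_cons]

theorem two_nsmul_add_inj {α : Type*} {g g' h h' : Multiset α} (hh : h.Nodup) (hh' : h'.Nodup)
    (e : 2 • g + h = 2 • g' + h') : g = g' ∧ h = h' := by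
  have key (a : α) : g.count a = g'.count a ∧ h.count a = h'.count a := by
    have h1 := congrArg (Multiset.count a) e
    simp only [Multiset.count_add, Multiset.count_nsmul] at h1
    have h2 := Multiset.nodup_iff_count_le_one.mp hh a
    have h3 := Multiset.nodup_iff_count_le_one.mp hh' a
    omega
  exact ⟨Multiset.ext.mpr fun a => (key a).1, Multiset.ext.mpr fun a => (key a).2⟩

/-- Splitting a stable multiset as twice a stable multiset plus a stable finite set. -/
def twiceAddSet {α : Type*} (φ : α → α) (n : ℕ) :
    (Σ i : Fin (n / 2 + 1), StableMultiset φ i × stableFinsets φ (n - 2 * i)) →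
      StableMultiset φ n :=
  fun x => ⟨2 • x.2.1.1 + x.2.2.1.val, by
    have hi := x.1.2
    refine ⟨?_, ?_⟩
    · rw [Multiset.card_add, Multiset.card_nsmul, x.2.1.2.1, Finset.card_val, x.2.2.2.1]
      omega
    · rw [Multiset.map_add, Multiset.map_nsmul, x.2.1.2.2, x.2.2.2.2]⟩

theorem twiceAddSet_bijective {α : Type*} {φ : α → α} (hφ : φ.Injective) (n : ℕ) :
    (twiceAddSet φ n).Bijective := by
  constructor
  · rintro ⟨⟨i, hi⟩, ⟨g, hg, hg'⟩, ⟨h, hh⟩⟩ ⟨⟨j, hj⟩, ⟨g₂, hg₂, hg₂'⟩, ⟨h₂, hh₂⟩⟩ e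
    obtain ⟨rfl, e₂⟩ := two_nsmul_add_inj h.nodup h₂.nodup (congrArg Subtype.val e)
    obtain rfl := Finset.val_inj.mp e₂
    obtain rfl : i = j := hg.symm.trans hg₂
    rfl
  · rintro ⟨s, hs, hs'⟩
    obtain ⟨g, h, rfl⟩ := exists_eq_two_nsmul_add_val s
    rw [Multiset.map_add, Multiset.map_nsmul] at hs'
    obtain ⟨hg, hh⟩ := two_nsmul_add_inj (h.nodup.map hφ) h.nodup hs'
    rw [Multiset.card_add, Multiset.card_nsmul, Finset.card_val] at hs
    exact ⟨⟨⟨g.card, by omega⟩, ⟨g, rfl, hg⟩, ⟨h, (by simp only; omega : h.card = _), hh⟩⟩, rfl⟩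

theorem finite_stableFinsets {α : Type*} (φ : α → α) (n : ℕ) [Finite (StableMultiset φ n)] :
    (stableFinsets φ n).Finite :=
  Set.finite_coe_iff.mp <| Finite.of_injective
    (fun S : stableFinsets φ n => (⟨S.1.val, S.2⟩ : StableMultiset φ n))
    fun _ _ e => Subtype.ext (Finset.val_inj.mp (congrArg Subtype.val e))

theorem card_stableMultiset_eq_sum {α : Type*} {φ : α → α} (hφ : φ.Injective)
    (hfin : ∀ n, Finite (StableMultiset φ n)) (n : ℕ) :
    Nat.card (StableMultiset φ n) = ∑ i ∈ Finset.range (n / 2 + 1),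
      Nat.card (StableMultiset φ i) * (stableFinsets φ (n - 2 * i)).ncard := by
  have hfin' (n : ℕ) : Finite (stableFinsets φ n) := (finite_stableFinsets φ n).to_subtype
  rw [← Nat.card_eq_of_bijective _ (twiceAddSet_bijective hφ n), Nat.card_sigma,
    Finset.sum_range]
  exact Finset.sum_congr rfl fun i _ => by rw [Nat.card_prod, Nat.card_coe_set_eq]

theorem ncard_stableFinsets_add_two {α : Type*} {φ : α → α} (hφ : φ.Injective) {q : ℕ}
    (hq : 0 < q) (hcard : ∀ n, Nat.card (StableMultiset φ n) = q ^ n) (n : ℕ) :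
    (stableFinsets φ (n + 2)).ncard + q ^ (n + 1) = q ^ (n + 2) := by
  have hfin (n : ℕ) : Finite (StableMultiset φ n) :=
    Nat.finite_of_card_ne_zero (by rw [hcard]; positivity)
  have h₀ := card_stableMultiset_eq_sum hφ hfin n
  have h₂ := card_stableMultiset_eq_sum hφ hfin (n + 2)
  rw [Finset.sum_range_succ', show (n + 2) / 2 = n / 2 + 1 by omega] at h₂
  simp only [hcard] at h₀ h₂
  have e : ∑ i ∈ Finset.range (n / 2 + 1),
      q ^ (i + 1) * (stableFinsets φ (n + 2 - 2 * (i + 1))).ncard = q * q ^ n := by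
    rw [h₀, Finset.mul_sum]
    refine Finset.sum_congr rfl fun i _ => ?_
    rw [show n + 2 - 2 * (i + 1) = n - 2 * i by omega]
    ring
  rw [e] at h₂
  simp only [mul_zero, tsub_zero, pow_zero, one_mul] at h₂
  rw [h₂, pow_succ' q n, add_comm]

theorem ncard_stableFinsets_zero {α : Type*} (φ : α → α) : (stableFinsets φ 0).ncard = 1 := by
  rw [Set.ncard_eq_one]
  refine ⟨∅, Set.eq_singleton_iff_unique_mem.mpr ⟨by simp [stableFinsets], fun S hS => ?_⟩⟩
  exact Finset.card_eq_zero.mp hS.1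

theorem ncard_stableFinsets_one {α : Type*} {φ : α → α} (hφ : φ.Injective)
    (hfin : ∀ n, Finite (StableMultiset φ n)) :
    (stableFinsets φ 1).ncard = Nat.card (StableMultiset φ 1) := by
  have h₀ := card_stableMultiset_eq_sum hφ hfin 0
  have h₁ := card_stableMultiset_eq_sum hφ hfin 1
  simp [ncard_stableFinsets_zero] at h₀ h₁
  have : Nat.card (StableMultiset φ 0) = 1 := by
    rw [Nat.card_eq_one_iff_unique]
    refine ⟨⟨fun a b => Subtype.ext ?_⟩, ⟨⟨0, by simp⟩⟩⟩
    rw [Multiset.card_eq_zero.mp a.2.1, Multiset.card_eq_zero.mp b.2.1]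
  rw [h₁, this, one_mul]

theorem ncard_stableFinsets_succ {α : Type*} {φ : α → α} (a : α) (ha : φ a = a) (n : ℕ)
    (hfin : (stableFinsets φ (n + 1)).Finite) :
    (stableFinsets φ (n + 1)).ncard =
      {S ∈ stableFinsets φ (n + 1) | a ∉ S}.ncard + {S ∈ stableFinsets φ n | a ∉ S}.ncard := by
  have hins : {S ∈ stableFinsets φ (n + 1) | a ∈ S}.ncard =
      {S ∈ stableFinsets φ n | a ∉ S}.ncard := by
    symm
    refine Set.ncard_congr (fun S _ => insert a S) ?_ ?_ ?_
    · rintro S ⟨⟨h₁, h₂⟩, h₃⟩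
      refine ⟨⟨by rw [Finset.card_insert_of_notMem h₃, h₁], ?_⟩, Finset.mem_insert_self a S⟩
      rw [Finset.insert_val_of_notMem h₃, Multiset.map_cons, h₂, ha]
    · rintro S T ⟨_, hS⟩ ⟨_, hT⟩ e
      rw [← Finset.erase_insert hS, ← Finset.erase_insert hT, e]
    · rintro S ⟨⟨h₁, h₂⟩, h₃⟩
      have hval : S.val = a ::ₘ (S.erase a).val := by
        rw [← Finset.insert_val_of_notMem (Finset.notMem_erase a S), Finset.insert_erase h₃]
      refine ⟨S.erase a, ⟨⟨by rw [Finset.card_erase_of_mem h₃, h₁]; rfl, ?_⟩,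
        Finset.notMem_erase a S⟩, Finset.insert_erase h₃⟩
      rw [hval, Multiset.map_cons, ha] at h₂
      exact (Multiset.cons_inj_right a).mp h₂
  rw [← hins, ← Set.ncard_union_eq (Set.disjoint_left.mpr fun S h h' => h.2 h'.2)
    (hfin.subset fun S h => h.1) (hfin.subset fun S h => h.1)]
  congr 1
  ext S
  exact ⟨fun h => (Classical.em (a ∈ S)).elim (fun ha => Or.inr ⟨h, ha⟩) fun ha => Or.inl ⟨h, ha⟩,
    fun h => h.elim And.left And.left⟩

/-- A Frobenius-fixed element of an extension of a finite field lies in that field. -/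
theorem mem_range_algebraMap_of_pow_card_eq {F K : Type*} [Field F] [Fintype F] [Field K]
    [Algebra F K] {x : K} (hx : x ^ Fintype.card F = x) : x ∈ (algebraMap F K).range := by
  have hs : (X ^ Fintype.card F - X : F[X]).Splits := by
    simpa using (FiniteField.isSplittingField_sub F F).splits
  refine hs.mem_range_of_isRoot (FiniteField.X_pow_card_sub_X_ne_zero F Fintype.one_lt_card) ?_
  simp [hx]

theorem card_stableMultiset_frobenius (F K : Type*) [Field F] [Fintype F] [Field K]
    [IsAlgClosed K] [Algebra F K] (n : ℕ) :
    Nat.card (StableMultiset (fun x : K => x ^ Fintype.card F) n) = Fintype.card F ^ n := by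
  let σ : K →ₐ[F] K := FiniteField.frobeniusAlgHom F K
  have hσ : (fun x : K => x ^ Fintype.card F) = (σ : K →+* K) := rfl
  rw [hσ]
  let r : {p : F[X] // p.Monic ∧ p.natDegree = n} → StableMultiset (σ : K →+* K) n := fun p =>
    ⟨(p.1.map (algebraMap F K)).roots, by
      constructor
      · rw [← (IsAlgClosed.splits _).natDegree_eq_card_roots, natDegree_map, p.2.2]
      · rw [← (IsAlgClosed.splits _).roots_map, Polynomial.map_map, AlgHom.comp_algebraMap]⟩
  have hr : r.Bijective := by
    constructor
    · intro p p' e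
      have e' : (p.1.map (algebraMap F K)).roots = (p'.1.map (algebraMap F K)).roots :=
        congrArg Subtype.val e
      refine Subtype.ext (map_injective _ (algebraMap F K).injective ?_)
      rw [(IsAlgClosed.splits _).eq_prod_roots_of_monic (p.2.1.map (algebraMap F K)), e',
        ← (IsAlgClosed.splits _).eq_prod_roots_of_monic (p'.2.1.map (algebraMap F K))]
    · rintro ⟨s, hs, hs'⟩
      have hfix : ((s.map (X - C ·)).prod).map (σ : K →+* K) = (s.map (X - C ·)).prod := by
        rw [Polynomial.map_multiset_prod, Multiset.map_map]
        conv_rhs => rw [← hs', Multiset.map_map]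
        simp
      have hlift : (s.map (X - C ·)).prod ∈ lifts (algebraMap F K) := by
        refine (lifts_iff_coeff_lifts _).mpr fun i => ?_
        refine mem_range_algebraMap_of_pow_card_eq ?_
        conv_rhs => rw [← hfix, coeff_map]
        rfl
      obtain ⟨p, hp, hdeg, hmon⟩ := lifts_and_natDegree_eq_and_monic hlift
        (monic_multiset_prod_of_monic _ _ fun a _ => monic_X_sub_C a)
      refine ⟨⟨p, hmon, ?_⟩, Subtype.ext ?_⟩
      · rw [hdeg, natDegree_multiset_prod_X_sub_C_eq_card, hs]
      · change (p.map (algebraMap F K)).roots = s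
        rw [hp, roots_multiset_prod_X_sub_C]
  rw [← Nat.card_eq_of_bijective r hr, Nat.card_congr (monicEquivDegreeLT n),
    Nat.card_congr (degreeLTEquiv F n).toEquiv, Nat.card_fun, Nat.card_eq_fintype_card,
    Nat.card_eq_fintype_card, Fintype.card_fin]

theorem stmt12 {F : Type} [Field F] [Fintype F] (n : ℕ) (hn : 1 ≤ n) :
    ((Fintype.card F : ℤ) + 1) *
      (Set.ncard {S : Finset (AlgebraicClosure F) |
          (0 : AlgebraicClosure F) ∉ S ∧ S.card = n ∧
          S.image (fun x => x ^ Fintype.card F) = S} : ℤ)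
    = ((Fintype.card F : ℤ) - 1) * ((Fintype.card F : ℤ) ^ n - (-1) ^ n) := by
  set q := Fintype.card F with hq
  let φ : AlgebraicClosure F → AlgebraicClosure F := fun x => x ^ q
  have hφ : φ.Injective := (FiniteField.frobeniusAlgHom F (AlgebraicClosure F)).injective
  have hq0 : 0 < q := Fintype.card_pos
  have hcard (n : ℕ) : Nat.card (StableMultiset φ n) = q ^ n :=
    card_stableMultiset_frobenius F (AlgebraicClosure F) n
  have hfin (n : ℕ) : Finite (StableMultiset φ n) :=
    Nat.finite_of_card_ne_zero (by rw [hcard]; positivity)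
  have hrec (n : ℕ) := ncard_stableFinsets_succ (φ := φ) 0 (zero_pow hq0.ne') n
    (finite_stableFinsets φ (n + 1))
  have hset (n : ℕ) : {S : Finset (AlgebraicClosure F) | (0 : AlgebraicClosure F) ∉ S ∧
      S.card = n ∧ S.image (fun x => x ^ q) = S} = {S ∈ stableFinsets φ n | 0 ∉ S} := by
    ext S
    have : S.image (fun x => x ^ q) = S ↔ S.val.map φ = S.val := by
      rw [← Finset.val_inj, Finset.image_val_of_injOn hφ.injOn]
    simp only [Set.mem_ofPred_eq, stableFinsets, this]
    tauto
  rw [hset]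
  have hzero : {S ∈ stableFinsets φ 0 | 0 ∉ S}.ncard = 1 := by
    rw [← ncard_stableFinsets_zero φ]
    congr 1
    exact Set.sep_eq_self_iff_mem_true.mpr fun S hS => by simp [Finset.card_eq_zero.mp hS.1]
  induction n, hn using Nat.le_induction with
  | base =>
    have h := hrec 0
    rw [zero_add, ncard_stableFinsets_one hφ hfin, hcard, hzero] at h
    zify at h
    linear_combination -((q : ℤ) + 1) * h
  | succ n hn ih =>
    obtain ⟨m, rfl⟩ := Nat.exists_eq_add_of_le' hn
    have h := hrec (m + 1)
    have h₂ := ncard_stableFinsets_add_two hφ hq0 hcard m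
    zify at h h₂
    linear_combination -((q : ℤ) + 1) * h + ((q : ℤ) + 1) * h₂ - ih

end Hyp
end
end
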